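/- The homogeneous quartic diophantine equation x₁⁴ − 11x₁²x₂² + x₂⁴ + x₃⁴ + 6x₃³x₄ + 7x₃²x₄² − 6x₃x₄³ + x₄⁴ = 0 has infinitely many pairwise non-proportional integer solutions; that is, there exists an infinite set of nonzero integer quadruples (x₁,x₂,x₃,x₄) satisfying the equation, no two of which are rational multiples of one another. In particular, starting from (1,1,1,1) one obtains an infinite sequence of such solutions with (x₁,x₂) = (3^t, 3^t) for t = 0, 1, 2, …. -/

import Mathlib

/-- The quartic form of the `h = 0` case of Section 3.2 of the paper. -/
def quarticH0 (v : Fin 4 → ℤ) : ℤ :=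
  v 0 ^ 4 - 11 * v 0 ^ 2 * v 1 ^ 2 + v 1 ^ 4 + v 2 ^ 4 + 6 * v 2 ^ 3 * v 3
    + 7 * v 2 ^ 2 * v 3 ^ 2 - 6 * v 2 * v 3 ^ 3 + v 3 ^ 4

/-- Two integer quadruples are proportional if one is a rational multiple of
the other. -/
def Proportional (v w : Fin 4 → ℤ) : Prop :=
  ∃ k : ℚ, (fun i => (w i : ℚ)) = fun i => k * (v i : ℚ)

/-- Coordinates, with respect to `1, ω` where `ω ^ 2 = 3 * ω + 1`, of the odd powers
`(1 + ω) ^ (2 * t + 1)`. -/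
def oddPowerCoords : ℕ → ℤ × ℤ
  | 0 => (1, 1)
  | t + 1 => (2 * (oddPowerCoords t).1 + 5 * (oddPowerCoords t).2,
      5 * (oddPowerCoords t).1 + 17 * (oddPowerCoords t).2)

theorem oddPowerCoords_norm (t : ℕ) :
    (oddPowerCoords t).1 ^ 2 + 3 * (oddPowerCoords t).1 * (oddPowerCoords t).2
      - (oddPowerCoords t).2 ^ 2 = 3 * (3 ^ t) ^ 2 := by
  induction t with
  | zero => simp [oddPowerCoords]
  | succ t ih =>
    simp only [oddPowerCoords, pow_succ (3 : ℤ) t]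
    linear_combination 9 * ih

theorem oddPowerCoords_mod_three (t : ℕ) :
    (oddPowerCoords t).1 % 3 = 1 ∧ (oddPowerCoords t).2 % 3 = 1 := by
  induction t with
  | zero => simp [oddPowerCoords]
  | succ t ih =>
    simp only [oddPowerCoords]
    omega

/-- The solution with first two coordinates `3 ^ t`. -/
def powThreeSolution (t : ℕ) : Fin 4 → ℤ :=
  ![3 ^ t, 3 ^ t, (oddPowerCoords t).1, (oddPowerCoords t).2]

theorem quarticH0_powThreeSolution (t : ℕ) : quarticH0 (powThreeSolution t) = 0 := by
  have h := oddPowerCoords_norm t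
  simp only [quarticH0, powThreeSolution, Matrix.cons_val]
  linear_combination ((oddPowerCoords t).1 ^ 2 + 3 * (oddPowerCoords t).1 * (oddPowerCoords t).2
      - (oddPowerCoords t).2 ^ 2 + 3 * (3 ^ t) ^ 2) * h

theorem le_of_pow_mul_eq_pow_mul {p a b : ℤ} (hp : p ≠ 0) {s t : ℕ} (hb : ¬ p ∣ b)
    (h : p ^ s * a = p ^ t * b) : s ≤ t := by
  by_contra! hlt
  obtain ⟨d, rfl⟩ := Nat.exists_eq_add_of_lt hlt
  refine hb ⟨p ^ d * a, mul_left_cancel₀ (pow_ne_zero t hp) ?_⟩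
  rw [← h]
  ring

theorem Proportional.mul_eq_mul {v w : Fin 4 → ℤ} (h : Proportional v w) (i j : Fin 4) :
    w i * v j = v i * w j := by
  obtain ⟨k, hk⟩ := h
  have hi : (w i : ℚ) = k * v i := congrFun hk i
  have hj : (w j : ℚ) = k * v j := congrFun hk j
  have : (w i : ℚ) * v j = v i * w j := by
    rw [hi, hj]
    ring
  exact_mod_cast this

theorem eq_of_proportional_powThreeSolution {s t : ℕ}
    (h : Proportional (powThreeSolution s) (powThreeSolution t)) : s = t := by
  have hst : (3 : ℤ) ^ t * (oddPowerCoords s).1 = 3 ^ s * (oddPowerCoords t).1 :=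
    h.mul_eq_mul 0 2
  have hndvd (u : ℕ) : ¬ (3 : ℤ) ∣ (oddPowerCoords u).1 := by
    have := oddPowerCoords_mod_three u
    omega
  exact le_antisymm (le_of_pow_mul_eq_pow_mul three_ne_zero (hndvd s) hst.symm)
    (le_of_pow_mul_eq_pow_mul three_ne_zero (hndvd t) hst)

theorem powThreeSolution_injective : Function.Injective powThreeSolution := fun s t h =>
  Int.pow_right_injective (show 1 < (3 : ℤ).natAbs by decide) (congrFun h 0)

/-- The equation `x₁⁴ − 11x₁²x₂² + x₂⁴ + x₃⁴ + 6x₃³x₄ + 7x₃²x₄² − 6x₃x₄³ + x₄⁴ = 0`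
has infinitely many pairwise non-proportional nonzero integer solutions; in
particular there are such solutions with `(x₁, x₂) = (3^t, 3^t)` for every `t`. -/
theorem stmt_9 : ∃ S : Set (Fin 4 → ℤ), S.Infinite
    ∧ (∀ v ∈ S, v ≠ 0 ∧ quarticH0 v = 0)
    ∧ (∀ v ∈ S, ∀ w ∈ S, v ≠ w → ¬ Proportional v w)
    ∧ (∀ t : ℕ, ∃ v ∈ S, v 0 = 3 ^ t ∧ v 1 = 3 ^ t) := by
  refine ⟨Set.range powThreeSolution, Set.infinite_range_of_injective powThreeSolution_injective,
    ?_, ?_, fun t => ⟨powThreeSolution t, ⟨t, rfl⟩, rfl, rfl⟩⟩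
  · rintro _ ⟨t, rfl⟩
    exact ⟨fun h => pow_ne_zero t three_ne_zero (congrFun h 0), quarticH0_powThreeSolution t⟩
  · rintro _ ⟨s, rfl⟩ _ ⟨t, rfl⟩ hne h
    exact hne (congrArg powThreeSolution (eq_of_proportional_powThreeSolution h))
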